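/- Let A be a p-algebra, let μ be a completely meet-irreducible congruence on A, and let ν be a congruence on A with exactly two equivalence classes. Then μ ⊆ ν (as sets of pairs) if and only if the ⊤-class of μ is contained in the ⊤-class of ν. -/

import Mathlib

variable {A : Type*}

/-- A congruence of a p-algebra `(A, ⊓, ⊔, *, ⊥, ⊤)`: an equivalence relation
compatible with meet, join and the pseudocomplementation `star`. -/
def IsPCong [Lattice A] (star : A → A) (θ : A → A → Prop) : Prop :=
  Equivalence θ ∧
  (∀ a b c d : A, θ a b → θ c d → θ (a ⊓ c) (b ⊓ d)) ∧
  (∀ a b c d : A, θ a b → θ c d → θ (a ⊔ c) (b ⊔ d)) ∧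
  (∀ a b : A, θ a b → θ (star a) (star b))

/-- A completely meet-irreducible congruence: a congruence `μ` such that whenever `μ`
is the intersection of a (possibly empty) family of congruences, `μ` belongs to the
family.  (Taking the empty family, such a `μ` is never the total relation.) -/
def IsCMI [Lattice A] (star : A → A) (μ : A → A → Prop) : Prop :=
  IsPCong star μ ∧
  ∀ S : Set (A → A → Prop), (∀ θ ∈ S, IsPCong star θ) →
    (μ = fun a b => ∀ θ ∈ S, θ a b) → μ ∈ S

/-- A relation has exactly two equivalence classes. -/
def HasTwoClasses (θ : A → A → Prop) : Prop :=
  ∃ a b : A, ¬ θ a b ∧ ∀ c : A, θ c a ∨ θ c b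

/-- A prime filter of a lattice: proper, nonempty, upward closed, closed under `⊓`,
and `a ⊔ b ∈ F` implies `a ∈ F` or `b ∈ F`. -/
def IsPrimeFilter [Lattice A] (F : Set A) : Prop :=
  F.Nonempty ∧ F ≠ Set.univ ∧ (∀ a b : A, a ∈ F → a ≤ b → b ∈ F) ∧
  (∀ a b : A, a ∈ F → b ∈ F → a ⊓ b ∈ F) ∧
  (∀ a b : A, a ⊔ b ∈ F → a ∈ F ∨ b ∈ F)

/-- For `μ` completely meet-irreducible and `ν` a congruence with exactly two classes,
`μ ⊆ ν` iff the `⊤`-class of `μ` is contained in the `⊤`-class of `ν`. -/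
theorem stmt9 [DistribLattice A] [BoundedOrder A] (star : A → A)
    (hp : ∀ x y : A, x ⊓ y = ⊥ ↔ x ≤ star y)
    (μ ν : A → A → Prop) (hμ : IsCMI star μ)
    (hν : IsPCong star ν) (hν2 : HasTwoClasses ν) :
    (∀ a b : A, μ a b → ν a b) ↔ {a : A | μ a ⊤} ⊆ {a : A | ν a ⊤} := by
  obtain ⟨⟨mr, ms, mt⟩, mi, -, mst⟩ := hμ.1
  obtain ⟨⟨nr, ns, nt⟩, ni, -, nst⟩ := hν
  obtain ⟨p, q, hpq, hcl⟩ := hν2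
  have sb : star ⊥ = ⊤ := top_le_iff.1 ((hp ⊤ ⊥).1 (by simp))
  have st : star ⊤ = ⊥ := by
    have := (hp (star ⊤) ⊤).2 le_rfl
    simpa using this
  have hbt : ¬ ν ⊥ ⊤ := by
    intro h
    have hall : ∀ x, ν ⊥ x := by
      intro x
      have := ni _ _ _ _ h (nr x)
      simpa using this
    exact hpq (nt (ns (hall p)) (hall q))
  have two : ∀ c, ν c ⊥ ∨ ν c ⊤ := by
    intro c
    rcases hcl c with h | h <;> rcases hcl ⊥ with h1 | h1 <;> rcases hcl ⊤ with h2 | h2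
    · exact (Or.inl (nt h (ns h1)))
    · exact (Or.inl (nt h (ns h1)))
    · exact (Or.inr (nt h (ns h2)))
    · exact absurd (nt h1 (ns h2)) hbt
    · exact absurd (nt h1 (ns h2)) hbt
    · exact (Or.inr (nt h (ns h2)))
    · exact (Or.inl (nt h (ns h1)))
    · exact (Or.inl (nt h (ns h1)))
  constructor
  · intro h a ha
    exact h _ _ ha
  · intro h
    have key : ∀ a b, μ a b → ν a ⊤ → ν b ⊥ → False := by
      intro a b hab ha hb
      have h1 := mi _ _ _ _ hab (mr (star b))
      have h2 : b ⊓ star b = ⊥ := by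
        rw [inf_comm]
        exact (hp (star b) b).2 le_rfl
      rw [h2] at h1
      have h3 := mst _ _ h1
      rw [sb] at h3
      have h4 : ν (star (a ⊓ star b)) ⊤ := h h3
      have h5 := nst _ _ hb
      rw [sb] at h5
      have h6 := nst _ _ (ni _ _ _ _ ha h5)
      rw [inf_top_eq, st] at h6
      exact hbt (nt (ns h6) h4)
    intro a b hab
    rcases two a with ha | ha <;> rcases two b with hb | hb
    · exact nt ha (ns hb)
    · exact (key _ _ (ms hab) hb ha).elim
    · exact (key _ _ hab ha hb).elim
    · exact nt ha (ns hb)
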